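/- arXiv:2110.12036 — 2 statements merged into one kernel-verified Lean document; each statement's English description precedes it below -/
import Mathlib

section
/- Let M be a MAG over vertex set V. If for every Y adjacent to X and every Z ∈ (Ch(X) ∪ N(X))\{Y} the vertices Y and Z are adjacent, and for every collider path (X, V₁, …, V_m, Y) and every Z ∉ {X,Y,V₁,…,V_m} with {X,V₁,…,V_m} ⊆ Pa(Z) the vertices Y and Z are adjacent, then X is removable in M. -/
/-- A mixed graph with directed (`dir x y` : x → y), bidirected and undirected edges. -/
structure MixedGraph (V : Type*) where
  dir : V → V → Prop
  bi : V → V → Prop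
  und : V → V → Prop
  bi_symm : ∀ x y, bi x y → bi y x
  und_symm : ∀ x y, und x y → und y x

namespace MixedGraph

variable {V : Type*}

def adj (G : MixedGraph V) (x y : V) : Prop :=
  G.dir x y ∨ G.dir y x ∨ G.bi x y ∨ G.und x y

/-- There is an arrowhead at `y` on the edge between `x` and `y`. -/
def head (G : MixedGraph V) (x y : V) : Prop := G.dir x y ∨ G.bi x y

def pa (G : MixedGraph V) (x : V) : Set V := {y | G.dir y x}
def child (G : MixedGraph V) (x : V) : Set V := {y | G.dir x y}
def nbr (G : MixedGraph V) (x : V) : Set V := {y | G.und x y}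
def spouse (G : MixedGraph V) (x : V) : Set V := {y | G.bi x y}

/-- `x` is an ancestor of `y` (every vertex is an ancestor of itself). -/
def anc (G : MixedGraph V) (x y : V) : Prop := Relation.ReflTransGen G.dir x y

def ancSet (G : MixedGraph V) (S : Set V) : Set V := {x | ∃ y ∈ S, G.anc x y}

/-- The set of descendants of `x` (including `x` itself). -/
def desc (G : MixedGraph V) (x : V) : Set V := {y | G.anc x y}

/-- A path, encoded as a duplicate-free list of at least two vertices with
consecutive vertices adjacent. -/
def IsPath (G : MixedGraph V) (p : List V) : Prop :=
  p.Chain' G.adj ∧ p.Nodup ∧ 2 ≤ p.length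

def IsPathBetween (G : MixedGraph V) (p : List V) (x y : V) : Prop :=
  G.IsPath p ∧ p.head? = some x ∧ p.getLast? = some y

/-- The vertex at (internal) position `i` of `p` is a collider: both incident
path edges have an arrowhead at it. -/
def ColliderAt (G : MixedGraph V) (p : List V) (i : ℕ) : Prop :=
  ∃ a v c, p[i-1]? = some a ∧ p[i]? = some v ∧ p[i+1]? = some c ∧
    G.head a v ∧ G.head c v

/-- A collider path: every non-endpoint vertex is a collider. -/
def IsColliderPath (G : MixedGraph V) (p : List V) : Prop :=
  G.IsPath p ∧ ∀ i, 1 ≤ i → i + 1 < p.length → G.ColliderAt p i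

/-- `p` is an m-connecting path between `x` and `y` relative to `Z`. -/
def MConn (G : MixedGraph V) (p : List V) (x y : V) (Z : Set V) : Prop :=
  G.IsPathBetween p x y ∧
  ∀ i v, 1 ≤ i → i + 1 < p.length → p[i]? = some v →
    (G.ColliderAt p i → v ∈ G.ancSet ({x, y} ∪ Z)) ∧
    (¬ G.ColliderAt p i → v ∉ Z)

/-- `Z` m-separates `x` and `y` in `G`. -/
def MSep (G : MixedGraph V) (x y : V) (Z : Set V) : Prop :=
  ∀ p, ¬ G.MConn p x y Z

/-- Induced subgraph over a set `S` of vertices. -/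
def induce (G : MixedGraph V) (S : Set V) : MixedGraph V where
  dir x y := G.dir x y ∧ x ∈ S ∧ y ∈ S
  bi x y := G.bi x y ∧ x ∈ S ∧ y ∈ S
  und x y := G.und x y ∧ x ∈ S ∧ y ∈ S
  bi_symm := fun x y h => ⟨G.bi_symm x y h.1, h.2.2, h.2.1⟩
  und_symm := fun x y h => ⟨G.und_symm x y h.1, h.2.2, h.2.1⟩

/-- `X` is removable in `G`: the induced subgraph on the remaining vertices
imposes exactly the same m-separation relations over them as `G`. -/
def Removable (G : MixedGraph V) (X : V) : Prop :=
  ∀ Y W : V, Y ≠ X → W ≠ X → Y ≠ W →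
    ∀ Z : Set V, Z ⊆ {v | v ≠ X ∧ v ≠ Y ∧ v ≠ W} →
      (G.MSep Y W Z ↔ (G.induce {v | v ≠ X}).MSep Y W Z)

/-- Ancestral: no directed cycles, no almost directed cycles, and endpoints of
undirected edges have no parents or spouses. -/
def Ancestral (G : MixedGraph V) : Prop :=
  (∀ x y, G.dir x y → ¬ G.anc y x) ∧
  (∀ x y, G.bi x y → ¬ G.anc y x) ∧
  (∀ x y, G.und x y → ∀ z, ¬ G.dir z x ∧ ¬ G.bi z x)

/-- A maximal ancestral graph: ancestral, and any two non-adjacent vertices are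
m-separated by some set. -/
def IsMAG (G : MixedGraph V) : Prop :=
  G.Ancestral ∧
  ∀ x y, x ≠ y → ¬ G.adj x y →
    ∃ Z : Set V, Z ⊆ {v | v ≠ x ∧ v ≠ y} ∧ G.MSep x y Z

/-- Markov boundary of `x`: the vertices with a collider path to `x`. -/
def Mb (G : MixedGraph V) (x : V) : Set V :=
  {y | ∃ p, G.IsColliderPath p ∧ p.head? = some y ∧ p.getLast? = some x}

/-- District of `x`: vertices joined to `x` by a path of bidirected edges. -/
def district (G : MixedGraph V) (x : V) : Set V :=
  {y | Relation.ReflTransGen G.bi x y}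

/-- `Pa⁺(x) = Pa(x) ∪ Dis(x) ∪ Pa(Dis(x)) ∪ N(x)`. -/
def paPlus (G : MixedGraph V) (x : V) : Set V :=
  G.pa x ∪ G.district x ∪ (⋃ y ∈ G.district x, G.pa y) ∪ G.nbr x

noncomputable def deltaPlus [Fintype V] (G : MixedGraph V) : ℕ :=
  Finset.univ.sup fun z : V => (G.paPlus z).ncard

/-- Condition 1 of the graphical characterization of removability. -/
def RemCond1 (G : MixedGraph V) (X : V) : Prop :=
  ∀ Y Z : V, G.adj X Y → Z ∈ G.child X ∪ G.nbr X → Z ≠ Y → G.adj Y Z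

/-- Condition 2 of the graphical characterization of removability. -/
def RemCond2 (G : MixedGraph V) (X : V) : Prop :=
  ∀ (p : List V) (Y Z : V), G.IsColliderPath p → p.head? = some X →
    p.getLast? = some Y → Z ∉ p → (∀ v ∈ p.dropLast, G.dir v Z) → G.adj Y Z

end MixedGraph

namespace MixedGraph

variable {V : Type*}

/-- Consecutive entries are related by `R` and consecutive triples satisfy `S`. -/
def Triples (R : V → V → Prop) (S : V → V → V → Prop) : List V → Prop
  | u :: v :: w :: l => R u v ∧ S u v w ∧ Triples R S (v :: w :: l)
  | [u, v] => R u v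
  | _ => True

theorem triples_iff {R : V → V → Prop} {S : V → V → V → Prop} {p : List V} :
    Triples R S p ↔ p.IsChain R ∧
      ∀ i a v c, p[i]? = some a → p[i + 1]? = some v → p[i + 2]? = some c → S a v c := by
  induction p with
  | nil => simp [Triples]
  | cons u l ih =>
    match l, ih with
    | [], _ => simp [Triples]
    | [v], _ => simp [Triples]
    | v :: w :: l, ih =>
      simp only [Triples, ih, List.isChain_cons_cons]
      constructor
      · rintro ⟨h1, h2, h3, h4⟩
        refine ⟨⟨h1, h3⟩, ?_⟩
        rintro (_ | i) a b c ha hb hc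
        · simp at ha hb hc
          subst ha hb hc
          exact h2
        · exact h4 i a b c (by simpa using ha) (by simpa using hb) (by simpa using hc)
      · rintro ⟨⟨h1, h2⟩, h3⟩
        refine ⟨h1, h3 0 u v w (by simp) (by simp) (by simp), h2, fun i a b c ha hb hc => ?_⟩
        exact h3 (i + 1) a b c (by simpa using ha) (by simpa using hb) (by simpa using hc)

theorem Triples.of_append {R : V → V → Prop} {S : V → V → V → Prop} {l r : List V}
    (h : Triples R S (l ++ r)) : Triples R S r := by
  induction l with
  | nil => exact h
  | cons u l ih =>
    apply ih
    rw [List.cons_append] at h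
    generalize l ++ r = q at h
    match q, h with
    | [], _ => trivial
    | [_], _ => trivial
    | _ :: _ :: _, h => exact h.2.2

theorem triples_reverse_append {R : V → V → Prop} {S : V → V → V → Prop}
    (hR : ∀ u v, R u v → R v u) (hS : ∀ u v w, S u v w → S w v u) (l r : List V) (a b : V) :
    Triples R S ((a :: l).reverse ++ b :: r) ↔
      Triples R S (b :: a :: l) ∧ Triples R S (a :: b :: r) := by
  induction l generalizing a b r with
  | nil =>
    simp only [List.reverse_singleton, List.singleton_append, Triples]
    refine ⟨fun h => ⟨?_, h⟩, fun h => h.2⟩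
    cases r with
    | nil => exact hR _ _ h
    | cons c r => exact hR _ _ h.1
  | cons d l ih =>
    have : (a :: d :: l).reverse ++ b :: r = (d :: l).reverse ++ a :: (b :: r) := by simp
    rw [this, ih]
    simp only [Triples]
    constructor
    · rintro ⟨h1, h2, h3, h4⟩
      refine ⟨⟨?_, hS _ _ _ h3, h1⟩, h4⟩
      cases r with
      | nil => exact hR _ _ h4
      | cons c r => exact hR _ _ h4.1
    · rintro ⟨⟨h1, h2, h3⟩, h4⟩
      refine ⟨h3, ?_, hS _ _ _ h2, h4⟩
      cases l with
      | nil => exact hR _ _ h3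
      | cons c r => exact hR _ _ h3.1

theorem Triples.reverse {R : V → V → Prop} {S : V → V → V → Prop}
    (hR : ∀ u v, R u v → R v u) (hS : ∀ u v w, S u v w → S w v u) {p : List V}
    (h : Triples R S p) : Triples R S p.reverse := by
  match p, h with
  | [], _ => trivial
  | [_], _ => trivial
  | a :: b :: l, h =>
    have : (a :: b :: l).reverse = (b :: l).reverse ++ a :: [] := by simp
    rw [this, triples_reverse_append hR hS]
    refine ⟨h, ?_⟩
    cases l with
    | nil => exact hR _ _ h
    | cons c r => exact hR _ _ h.1

theorem adj_symm (G : MixedGraph V) (x y : V) (h : G.adj x y) : G.adj y x := by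
  rcases h with h | h | h | h
  · exact Or.inr (Or.inl h)
  · exact Or.inl h
  · exact Or.inr (Or.inr (Or.inl (G.bi_symm _ _ h)))
  · exact Or.inr (Or.inr (Or.inr (G.und_symm _ _ h)))

theorem head.adj {G : MixedGraph V} {x y : V} (h : G.head x y) : G.adj x y := by
  rcases h with h | h
  · exact Or.inl h
  · exact Or.inr (Or.inr (Or.inl h))

namespace Ancestral

variable {G : MixedGraph V}

theorem not_head_of_anc (hG : G.Ancestral) {x y : V} (h : G.anc y x) : ¬ G.head x y := by
  rintro (h' | h')
  · exact hG.1 _ _ h' h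
  · exact hG.2.1 _ _ h' h

theorem not_head_of_dir (hG : G.Ancestral) {x y : V} (h : G.dir y x) : ¬ G.head x y :=
  hG.not_head_of_anc (.single h)

theorem not_bi_of_anc (hG : G.Ancestral) {x y : V} (h : G.anc x y) : ¬ G.bi x y :=
  fun h' => hG.2.1 _ _ (G.bi_symm _ _ h') h

theorem not_head_of_und (hG : G.Ancestral) {x y z : V} (h : G.und x y) : ¬ G.head z x := by
  rintro (h' | h')
  · exact (hG.2.2 _ _ h z).1 h'
  · exact (hG.2.2 _ _ h z).2 h'

theorem ne_of_dir (hG : G.Ancestral) {x y : V} (h : G.dir x y) : x ≠ y := by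
  rintro rfl
  exact hG.1 _ _ h .refl

/-- If `z` has an incoming arrowhead, an edge between `w` and `z` which is not `z → w` points
into `z`. -/
theorem head_of_adj (hG : G.Ancestral) {u w z : V} (hu : G.head u z) (h : G.adj w z)
    (hn : ¬ G.dir z w) : G.head w z := by
  rcases h with h | h | h | h
  · exact Or.inl h
  · exact absurd h hn
  · exact Or.inr h
  · exact absurd hu (hG.not_head_of_und (G.und_symm _ _ h))

/-- If `w ↔ z` and `v → z`, an edge between `v` and `w` has an arrowhead at `w`. -/
theorem head_of_bi (hG : G.Ancestral) {v w z : V} (hb : G.bi w z) (hv : G.dir v z)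
    (h : G.adj v w) : G.head v w := by
  rcases h with h | h | h | h
  · exact Or.inl h
  · exact absurd hb (hG.not_bi_of_anc (.tail (.single h) hv))
  · exact Or.inr h
  · exact absurd (Or.inr (G.bi_symm _ _ hb)) (hG.not_head_of_und (z := z) (G.und_symm _ _ h))

end Ancestral

/-- The vertex `v` between `u` and `w` does not block: it lies in `A` if it is a collider, and
outside `Z` otherwise. -/
def Unblocked (G : MixedGraph V) (A Z : Set V) (u v w : V) : Prop :=
  (G.head u v ∧ G.head w v → v ∈ A) ∧ (¬ (G.head u v ∧ G.head w v) → v ∉ Z)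

theorem Unblocked.symm {G : MixedGraph V} {A Z : Set V} (u v w : V)
    (h : G.Unblocked A Z u v w) : G.Unblocked A Z w v u := by
  unfold Unblocked at *
  rwa [and_comm (a := G.head w v)]

theorem colliderAt_succ_iff {G : MixedGraph V} {p : List V} {i : ℕ} {a v c : V}
    (ha : p[i]? = some a) (hv : p[i + 1]? = some v) (hc : p[i + 2]? = some c) :
    G.ColliderAt p (i + 1) ↔ G.head a v ∧ G.head c v := by
  constructor
  · rintro ⟨a', v', c', ha', hv', hc', h⟩
    simp only [Nat.add_sub_cancel, ha, hv, Option.some.injEq] at ha' hv'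
    rw [show i + 1 + 1 = i + 2 from rfl, hc, Option.some.injEq] at hc'
    subst ha' hv' hc'
    exact h
  · exact fun h => ⟨a, v, c, by simpa using ha, hv, hc, h⟩

theorem isColliderPath_of_triples {G : MixedGraph V} {p : List V}
    (h : Triples G.adj (fun a v c => G.head a v ∧ G.head c v) p) (hn : p.Nodup)
    (hl : 2 ≤ p.length) : G.IsColliderPath p := by
  rw [triples_iff] at h
  refine ⟨⟨h.1, hn, hl⟩, fun i hi hi' => ?_⟩
  obtain ⟨i, rfl⟩ : ∃ j, i = j + 1 := ⟨i - 1, by omega⟩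
  have ha := List.getElem?_eq_getElem (l := p) (i := i) (by omega)
  have hv := List.getElem?_eq_getElem (l := p) (i := i + 1) (by omega)
  have hc := List.getElem?_eq_getElem (l := p) (i := i + 2) (by omega)
  exact (colliderAt_succ_iff ha hv hc).2 (h.2 i _ _ _ ha hv hc)

theorem mConn_iff_triples {G : MixedGraph V} {p : List V} {x y : V} {Z : Set V} :
    G.MConn p x y Z ↔ Triples G.adj (G.Unblocked (G.ancSet ({x, y} ∪ Z)) Z) p ∧
      p.Nodup ∧ 2 ≤ p.length ∧ p.head? = some x ∧ p.getLast? = some y := by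
  rw [triples_iff]
  constructor
  · rintro ⟨⟨⟨h1, h2, h3⟩, h4, h5⟩, h6⟩
    refine ⟨⟨h1, fun i a v c ha hv hc => ?_⟩, h2, h3, h4, h5⟩
    have hlt : i + 2 < p.length := (List.getElem?_eq_some_iff.1 hc).1
    have := h6 (i + 1) v (by omega) hlt hv
    rwa [colliderAt_succ_iff ha hv hc] at this
  · rintro ⟨⟨h1, h6⟩, h2, h3, h4, h5⟩
    refine ⟨⟨⟨h1, h2, h3⟩, h4, h5⟩, fun i v hi hi' hv => ?_⟩
    obtain ⟨i, rfl⟩ : ∃ j, i = j + 1 := ⟨i - 1, by omega⟩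
    have ha := List.getElem?_eq_getElem (l := p) (i := i) (by omega)
    have hc := List.getElem?_eq_getElem (l := p) (i := i + 2) (by omega)
    rw [colliderAt_succ_iff ha hv hc]
    exact h6 i _ _ _ ha hv hc

theorem Triples.change_head {G : MixedGraph V} {A Z : Set V} {u u' v : V} {l : List V}
    (h : Triples G.adj (G.Unblocked A Z) (u :: v :: l)) (ha : G.adj u' v)
    (hu : G.head u v ↔ G.head u' v) : Triples G.adj (G.Unblocked A Z) (u' :: v :: l) := by
  cases l with
  | nil => exact ha
  | cons w l =>
    refine ⟨ha, ?_, h.2.2⟩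
    have := h.2.1
    unfold Unblocked at *
    rwa [← hu]

theorem Triples.adj_head {R : V → V → Prop} {S : V → V → V → Prop} {u v : V} {l : List V}
    (h : Triples R S (u :: v :: l)) : R u v := by
  cases l with
  | nil => exact h
  | cons w l => exact h.1

theorem exists_suffix_of_collider_stack {G : MixedGraph V} (hG : G.Ancestral) {X : V}
    (h2 : G.RemCond2 X) {A Z : Set V} {z : V} (l : List V) (v u : V) (C : List V)
    (hC : Triples G.adj (fun a v c => G.head a v ∧ G.head c v) (v :: u :: C))
    (hlast : (u :: C).getLast? = some X) (hz : ∀ x ∈ u :: C, G.dir x z)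
    (hn : (u :: C ++ v :: l).Nodup)
    (hT : Triples G.adj (G.Unblocked A Z) (u :: v :: l)) (hvz : G.head v z) :
    ∃ w l', w :: l' <:+ v :: l ∧ G.head w z ∧
      Triples G.adj (G.Unblocked A Z) (z :: w :: l') := by
  induction l generalizing v u C with
  | nil => exact ⟨v, [], List.suffix_refl _, hvz, G.adj_symm _ _ hvz.adj⟩
  | cons w l ih =>
    have huz : G.dir u z := hz u (by simp)
    by_cases hb : G.bi v z
    · refine ⟨v, w :: l, List.suffix_refl _, hvz, hT.change_head (G.adj_symm _ _ hvz.adj) ?_⟩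
      exact iff_of_true (hG.head_of_bi hb huz hT.adj_head) (Or.inr (G.bi_symm _ _ hb))
    have hd : G.dir v z := hvz.resolve_right hb
    by_cases hc : G.head u v ∧ G.head w v
    · have hwv := hc.2
      have hzw : z ≠ w := by
        rintro rfl
        exact hG.not_head_of_dir hd hwv
      have hz' : ∀ x ∈ v :: u :: C, G.dir x z := by
        intro x hx
        rcases List.mem_cons.1 hx with rfl | hx
        · exact hd
        · exact hz x hx
      have hzmem : z ∉ w :: v :: u :: C := by
        intro hm
        rcases List.mem_cons.1 hm with h | h
        · exact hzw h
        · exact hG.ne_of_dir (hz' z h) rfl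
      have hn' : (w :: v :: u :: C).Nodup := by
        simp only [List.nodup_append, List.nodup_cons, List.mem_cons] at hn ⊢
        grind
      have hn'' : (v :: u :: C ++ w :: l).Nodup := by
        simp only [List.cons_append, List.nodup_append, List.nodup_cons, List.mem_cons,
          List.mem_append] at hn ⊢
        grind
      have hC' : Triples G.adj (fun a v c => G.head a v ∧ G.head c v) (w :: v :: u :: C) :=
        ⟨hwv.adj, ⟨hwv, hc.1⟩, hC⟩
      have hadj : G.adj w z := by
        refine h2 (w :: v :: u :: C).reverse w z (isColliderPath_of_triples
          (hC'.reverse G.adj_symm fun _ _ _ h => h.symm) (List.nodup_reverse.2 hn') (by simp))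
          ?_ (by simp) (mt List.mem_reverse.1 hzmem) ?_
        · rw [List.head?_reverse]
          simpa [List.getLast?_cons_cons] using hlast
        · intro x hx
          apply hz'
          rw [List.dropLast_reverse] at hx
          exact List.mem_reverse.1 hx
      have hwz : G.head w z := hG.head_of_adj (Or.inl hd) hadj fun h =>
        hG.not_head_of_anc (.tail (.single hd) h) hwv
      obtain ⟨w', l', hs, h⟩ := ih w v (u :: C) hC'
        (by simpa [List.getLast?_cons_cons] using hlast) hz' hn'' hT.2.2 hwz
      exact ⟨w', l', hs.trans (List.suffix_cons _ _), h⟩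
    · refine ⟨v, w :: l, List.suffix_refl _, hvz, G.adj_symm _ _ hvz.adj, ?_, hT.2.2⟩
      exact ⟨fun h => absurd h.1 (hG.not_head_of_dir hd), fun _ => hT.2.1.2 hc⟩

/-- A connecting path arriving at `X` can be rerouted, after dropping its last few vertices, to
arrive at a child `z` of `X` with an arrowhead at `z`. -/
theorem exists_suffix_of_dir {G : MixedGraph V} (hG : G.Ancestral) {X : V}
    (h1 : G.RemCond1 X) (h2 : G.RemCond2 X) {A Z : Set V} {z a : V} {l : List V}
    (hXz : G.dir X z) (haz : a ≠ z) (hza : ¬ G.dir z a) (hn : (X :: a :: l).Nodup)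
    (hT : Triples G.adj (G.Unblocked A Z) (X :: a :: l)) :
    ∃ w l', w :: l' <:+ a :: l ∧ G.head w z ∧
      Triples G.adj (G.Unblocked A Z) (z :: w :: l') :=
  exists_suffix_of_collider_stack hG h2 l a X [] (G.adj_symm _ _ hT.adj_head) rfl
    (by simpa using hXz) hn hT
    (hG.head_of_adj (Or.inl hXz) (h1 _ _ hT.adj_head (Or.inl hXz) haz.symm) hza)

/-- Bypassing a non-collider `X` through its child `b`. -/
theorem exists_bypass_of_dir {G : MixedGraph V} (hG : G.Ancestral) {X : V}
    (h1 : G.RemCond1 X) (h2 : G.RemCond2 X) {A Z : Set V} {a b : V} {l r : List V}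
    (hXb : G.dir X b) (hab : a ≠ b) (hba : ¬ G.dir b a) (hn : (X :: a :: l).Nodup)
    (hL : Triples G.adj (G.Unblocked A Z) (X :: a :: l))
    (hR : Triples G.adj (G.Unblocked A Z) (X :: b :: r)) :
    ∃ w l', w :: l' <:+ a :: l ∧
      Triples G.adj (G.Unblocked A Z) ((w :: l').reverse ++ b :: r) := by
  obtain ⟨w, l', hs, hw, hT⟩ := exists_suffix_of_dir hG h1 h2 hXb hab hba hn hL
  refine ⟨w, l', hs, (triples_reverse_append G.adj_symm Unblocked.symm _ _ _ _).2 ⟨hT, ?_⟩⟩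
  exact hR.change_head hw.adj (iff_of_true (Or.inl hXb) hw)

/-- Entering a connecting path at an interior vertex `c ∈ A` through an arrowhead. -/
theorem Triples.enter_of_mem {G : MixedGraph V} {A Z : Set V} {X c w : V} {l : List V}
    (hT : Triples G.adj (G.Unblocked A Z) (X :: l)) (hc : c ∈ l) (hcA : c ∈ A)
    (hw : G.head w c) :
    ∃ l', c :: l' <:+ l ∧ Triples G.adj (G.Unblocked A Z) (w :: c :: l') := by
  obtain ⟨s, t, rfl⟩ := List.append_of_mem hc
  refine ⟨t, List.suffix_append _ _, ?_⟩
  cases t with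
  | nil => exact hw.adj
  | cons d t =>
    obtain ⟨s', e, hs⟩ : ∃ s' e, X :: s = s' ++ [e] :=
      ⟨_, _, (List.dropLast_append_getLast (List.cons_ne_nil X s)).symm⟩
    have hT' : Triples G.adj (G.Unblocked A Z) (s' ++ (e :: c :: d :: t)) := by
      have : X :: (s ++ c :: d :: t) = s' ++ (e :: c :: d :: t) := by
        rw [← List.cons_append, hs]
        simp
      rwa [this] at hT
    have h := hT'.of_append
    exact ⟨hw.adj, ⟨fun _ => hcA, fun hn => h.2.1.2 fun hd => hn ⟨hw, hd.2⟩⟩, h.2.2⟩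

/-- Bypassing a collider `X` through its child `c`. -/
theorem exists_bypass_of_collider {G : MixedGraph V} (hG : G.Ancestral) {X : V}
    (h1 : G.RemCond1 X) (h2 : G.RemCond2 X) {A Z : Set V} {a b c : V} {l r : List V}
    (hXc : G.dir X c) (hcA : c ∈ A) (ha : G.head a X) (hb : G.head b X)
    (hnl : (X :: a :: l).Nodup) (hnr : (X :: b :: r).Nodup)
    (hL : Triples G.adj (G.Unblocked A Z) (X :: a :: l))
    (hR : Triples G.adj (G.Unblocked A Z) (X :: b :: r)) :
    ∃ w l' v r', w :: l' <:+ a :: l ∧ v :: r' <:+ b :: r ∧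
      (Triples G.adj (G.Unblocked A Z) ((w :: l').reverse ++ v :: r') ∨
        c ∉ w :: l' ∧ c ∉ v :: r' ∧
          Triples G.adj (G.Unblocked A Z) ((w :: l').reverse ++ c :: v :: r')) := by
  have key : ∀ {a}, G.head a X → a ≠ c ∧ ¬ G.dir c a := by
    intro a ha
    refine ⟨?_, fun h => hG.not_head_of_anc (.tail (.single hXc) h) ha⟩
    rintro rfl
    exact hG.not_head_of_dir hXc ha
  obtain ⟨w, l', hwl, hw, hTw⟩ := exists_suffix_of_dir hG h1 h2 hXc (key ha).1 (key ha).2 hnl hL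
  obtain ⟨v, r', hvr, hv, hTv⟩ := exists_suffix_of_dir hG h1 h2 hXc (key hb).1 (key hb).2 hnr hR
  have join := fun (l r : List V) (a b : V) => (triples_reverse_append G.adj_symm
    (Unblocked.symm (G := G) (A := A) (Z := Z)) l r a b).2
  by_cases hcl : c ∈ a :: l
  · obtain ⟨l₁, hs, hT⟩ := hL.enter_of_mem hcl hcA hv
    exact ⟨c, l₁, v, r', hs, hvr, Or.inl (join _ _ _ _ ⟨hT, hTv⟩)⟩
  by_cases hcr : c ∈ b :: r
  · obtain ⟨r₁, hs, hT⟩ := hR.enter_of_mem hcr hcA hw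
    exact ⟨w, l', c, r₁, hwl, hs, Or.inl (join _ _ _ _ ⟨hTw, hT⟩)⟩
  refine ⟨w, l', v, r', hwl, hvr, Or.inr ⟨fun h => hcl (hwl.subset h),
    fun h => hcr (hvr.subset h), join _ _ _ _ ⟨hTw, hw.adj, ?_, hTv⟩⟩⟩
  exact ⟨fun _ => hcA, fun hn => absurd ⟨hw, hv⟩ hn⟩

/-- Bypassing a non-collider `X`. -/
theorem exists_bypass_of_not_collider {G : MixedGraph V} (hG : G.Ancestral) {X : V}
    (h1 : G.RemCond1 X) (h2 : G.RemCond2 X) {A Z : Set V} {a b : V} {l r : List V}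
    (hab : a ≠ b) (hc : ¬ (G.head a X ∧ G.head b X))
    (hnl : (X :: a :: l).Nodup) (hnr : (X :: b :: r).Nodup)
    (hL : Triples G.adj (G.Unblocked A Z) (X :: a :: l))
    (hR : Triples G.adj (G.Unblocked A Z) (X :: b :: r)) :
    ∃ w l' v r', w :: l' <:+ a :: l ∧ v :: r' <:+ b :: r ∧
      Triples G.adj (G.Unblocked A Z) ((w :: l').reverse ++ v :: r') := by
  have right : G.dir X b → ¬ G.dir b a → ∃ w l' v r', w :: l' <:+ a :: l ∧ v :: r' <:+ b :: r ∧
      Triples G.adj (G.Unblocked A Z) ((w :: l').reverse ++ v :: r') := by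
    intro h h'
    obtain ⟨w, l', hs, hT⟩ := exists_bypass_of_dir hG h1 h2 h hab h' hnl hL hR
    exact ⟨w, l', b, r, hs, List.suffix_refl _, hT⟩
  have left : G.dir X a → ¬ G.dir a b → ∃ w l' v r', w :: l' <:+ a :: l ∧ v :: r' <:+ b :: r ∧
      Triples G.adj (G.Unblocked A Z) ((w :: l').reverse ++ v :: r') := by
    intro h h'
    obtain ⟨w, r', hs, hT⟩ := exists_bypass_of_dir hG h1 h2 h hab.symm h' hnr hR hL
    refine ⟨a, l, w, r', List.suffix_refl _, hs, ?_⟩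
    simpa using hT.reverse G.adj_symm Unblocked.symm
  have hXa : G.adj X a := hL.adj_head
  have hXb : G.adj X b := hR.adj_head
  by_cases hda : G.dir X a
  · by_cases h : G.dir a b
    · refine right ?_ fun h' => hG.not_head_of_dir h (Or.inl h')
      rcases hXb with h' | h' | h' | h'
      · exact h'
      · exact absurd (Or.inl h') (hG.not_head_of_anc (.tail (.single hda) h))
      · exact absurd h' (hG.not_bi_of_anc (.tail (.single hda) h))
      · exact absurd (Or.inl h) (hG.not_head_of_und (z := a) (G.und_symm _ _ h'))
    · exact left hda h
  by_cases hdb : G.dir X b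
  · refine right hdb fun h => ?_
    rcases hXa with h' | h' | h' | h'
    · exact hda h'
    · exact hG.not_head_of_anc (.tail (.single hdb) h) (Or.inl h')
    · exact hG.not_bi_of_anc (.tail (.single hdb) h) h'
    · exact hG.not_head_of_und (G.und_symm _ _ h') (Or.inl h)
  have hu : G.und X a ∨ G.und X b := by
    rcases hXa with h | h | h | h
    · exact absurd h hda
    · rcases hXb with h' | h' | h' | h'
      · exact absurd h' hdb
      · exact absurd ⟨Or.inl h, Or.inl h'⟩ hc
      · exact absurd ⟨Or.inl h, Or.inr (G.bi_symm _ _ h')⟩ hc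
      · exact Or.inr h'
    · rcases hXb with h' | h' | h' | h'
      · exact absurd h' hdb
      · exact absurd ⟨Or.inr (G.bi_symm _ _ h), Or.inl h'⟩ hc
      · exact absurd ⟨Or.inr (G.bi_symm _ _ h), Or.inr (G.bi_symm _ _ h')⟩ hc
      · exact Or.inr h'
    · exact Or.inl h
  have hnX : ∀ z, ¬ G.head z X := fun z => hu.elim hG.not_head_of_und hG.not_head_of_und
  have und_of : ∀ {x}, G.adj X x → ¬ G.dir X x → G.und X x := by
    rintro x (h | h | h | h) hn
    · exact absurd h hn
    · exact absurd (Or.inl h) (hnX x)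
    · exact absurd (Or.inr (G.bi_symm _ _ h)) (hnX x)
    · exact h
  have hua := und_of hXa hda
  have hub := und_of hXb hdb
  have hadj : G.adj a b := h1 a b hXa (Or.inr hub) hab.symm
  have hna : ∀ z, ¬ G.head z a := fun z => hG.not_head_of_und (G.und_symm _ _ hua)
  have hnb : ∀ z, ¬ G.head z b := fun z => hG.not_head_of_und (G.und_symm _ _ hub)
  refine ⟨a, l, b, r, List.suffix_refl _, List.suffix_refl _,
    (triples_reverse_append G.adj_symm Unblocked.symm _ _ _ _).2 ⟨?_, ?_⟩⟩
  · exact hL.change_head (G.adj_symm _ _ hadj) (iff_of_false (hna _) (hna _))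
  · exact hR.change_head hadj (iff_of_false (hnb _) (hnb _))

/-- Every connecting path through `X` can be rerouted to avoid `X`. -/
theorem exists_triples_avoiding {G : MixedGraph V} (hG : G.Ancestral) {X : V}
    (h1 : G.RemCond1 X) (h2 : G.RemCond2 X) {Z S : Set V} {x y : V} (hxX : x ≠ X)
    (hyX : y ≠ X) (hXS : X ∉ S) {p : List V}
    (hT : Triples G.adj (G.Unblocked (G.ancSet S) Z) p) (hn : p.Nodup)
    (hx : p.head? = some x) (hy : p.getLast? = some y) :
    ∃ q, Triples G.adj (G.Unblocked (G.ancSet S) Z) q ∧ q.Nodup ∧ X ∉ q ∧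
      q.head? = some x ∧ q.getLast? = some y := by
  by_cases hXp : X ∉ p
  · exact ⟨p, hT, hn, hXp, hx, hy⟩
  obtain ⟨s, t, rfl⟩ := List.append_of_mem (not_not.1 hXp)
  obtain ⟨s, rfl⟩ : ∃ s', s = s'.reverse := ⟨s.reverse, by simp⟩
  cases s with
  | nil => simp [hxX.symm] at hx
  | cons a l =>
  cases t with
  | nil => simp [hyX.symm] at hy
  | cons b r =>
  obtain ⟨hL, hR'⟩ := (triples_reverse_append G.adj_symm Unblocked.symm _ _ _ _).1 hT
  have hR := hR'.2.2
  have hnl : (X :: a :: l).Nodup := by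
    simp only [List.nodup_append, List.nodup_reverse, List.nodup_cons, List.mem_reverse,
      List.mem_cons] at hn ⊢
    grind
  have hnr : (X :: b :: r).Nodup := (List.nodup_append.1 hn).2.1
  have hdisj : ∀ u ∈ a :: l, u ∉ b :: r := by
    intro u hu hu'
    exact (List.nodup_append.1 hn).2.2 u (List.mem_reverse.2 hu) u (List.mem_cons_of_mem _ hu') rfl
  have hab : a ≠ b := by
    rintro rfl
    exact hdisj a (by simp) (by simp)
  have hxl : (a :: l).getLast? = some x := by
    rwa [List.head?_append_of_ne_nil _ (by simp), List.head?_reverse] at hx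
  have hyr : (b :: r).getLast? = some y := by
    rwa [List.getLast?_append_of_ne_nil _ (by simp), List.getLast?_cons_cons] at hy
  have last_suffix : ∀ {l m : List V} {u w : V}, w :: l <:+ m → m.getLast? = some u →
      (w :: l).getLast? = some u := by
    rintro l m u w ⟨k, rfl⟩ h
    rwa [List.getLast?_append_of_ne_nil _ (by simp)] at h
  have finish : ∀ w l' v r', w :: l' <:+ a :: l → v :: r' <:+ b :: r →
      Triples G.adj (G.Unblocked (G.ancSet S) Z) ((w :: l').reverse ++ v :: r') →
      ∃ q, Triples G.adj (G.Unblocked (G.ancSet S) Z) q ∧ q.Nodup ∧ X ∉ q ∧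
        q.head? = some x ∧ q.getLast? = some y := by
    intro w l' v r' hl hr hT
    refine ⟨_, hT, ?_, ?_, ?_, ?_⟩
    · refine List.nodup_append.2 ⟨List.nodup_reverse.2 (hl.sublist.nodup hnl.of_cons),
        hr.sublist.nodup hnr.of_cons, fun u hu u' hu' he => ?_⟩
      subst he
      exact hdisj u (hl.subset (List.mem_reverse.1 hu)) (hr.subset hu')
    · intro h
      rcases List.mem_append.1 h with h | h
      · exact (List.nodup_cons.1 hnl).1 (hl.subset (List.mem_reverse.1 h))
      · exact (List.nodup_cons.1 hnr).1 (hr.subset h)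
    · rw [List.head?_append_of_ne_nil _ (by simp), List.head?_reverse]
      exact last_suffix hl hxl
    · rw [List.getLast?_append_of_ne_nil _ (by simp)]
      exact last_suffix hr hyr
  by_cases hc : G.head a X ∧ G.head b X
  · obtain ⟨s, hs, hXs⟩ : X ∈ G.ancSet S := hR'.2.1.1 hc
    rcases Relation.ReflTransGen.cases_head hXs with rfl | ⟨c, hXc, hcs⟩
    · exact absurd hs hXS
    have hcA : c ∈ G.ancSet S := ⟨s, hs, hcs⟩
    obtain ⟨w, l', v, r', hl, hr, hT | ⟨hcl, hcr, hT⟩⟩ :=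
      exists_bypass_of_collider hG h1 h2 hXc hcA hc.1 hc.2 hnl hnr hL hR
    · exact finish w l' v r' hl hr hT
    refine ⟨_, hT, ?_, ?_, ?_, ?_⟩
    · refine List.nodup_append.2 ⟨List.nodup_reverse.2 (hl.sublist.nodup hnl.of_cons),
        List.nodup_cons.2 ⟨hcr, hr.sublist.nodup hnr.of_cons⟩, fun u hu u' hu' he => ?_⟩
      subst he
      rcases List.mem_cons.1 hu' with rfl | hu'
      · exact hcl (List.mem_reverse.1 hu)
      · exact hdisj u (hl.subset (List.mem_reverse.1 hu)) (hr.subset hu')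
    · intro h
      rcases List.mem_append.1 h with h | h
      · exact (List.nodup_cons.1 hnl).1 (hl.subset (List.mem_reverse.1 h))
      rcases List.mem_cons.1 h with h | h
      · exact hG.ne_of_dir hXc h
      · exact (List.nodup_cons.1 hnr).1 (hr.subset h)
    · rw [List.head?_append_of_ne_nil _ (by simp), List.head?_reverse]
      exact last_suffix hl hxl
    · rw [List.getLast?_append_of_ne_nil _ (by simp), List.getLast?_cons_cons]
      exact last_suffix hr hyr
  · obtain ⟨w, l', v, r', hl, hr, hT⟩ :=
      exists_bypass_of_not_collider hG h1 h2 hab hc hnl hnr hL hR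
    exact finish w l' v r' hl hr hT

theorem anc_of_induce {G : MixedGraph V} {S : Set V} {x y : V} (h : (G.induce S).anc x y) :
    G.anc x y :=
  Relation.ReflTransGen.mono (fun _ _ h => h.1) _ _ h

/-- Ancestral relations survive the removal of a vertex satisfying the first condition. -/
theorem anc_induce_of_anc {G : MixedGraph V} (hG : G.Ancestral) {X : V} (h1 : G.RemCond1 X)
    {x y : V} (hx : x ≠ X) (hy : y ≠ X) (h : G.anc x y) :
    (G.induce {v | v ≠ X}).anc x y := by
  suffices (x ≠ X → (G.induce {v | v ≠ X}).anc x y) ∧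
      (x = X → ∃ c, G.dir X c ∧ c ≠ X ∧ (G.induce {v | v ≠ X}).anc c y) from this.1 hx
  clear hx
  induction h using Relation.ReflTransGen.head_induction_on with
  | refl => exact ⟨fun _ => .refl, fun h => absurd h hy⟩
  | @head a c hac _ ih =>
    constructor
    · intro ha
      by_cases hc : c = X
      · obtain ⟨d, hXd, hd, hdy⟩ := ih.2 hc
        subst hc
        have hne : d ≠ a := by
          rintro rfl
          exact hG.not_head_of_dir hXd (Or.inl hac)
        have had := hG.head_of_adj (Or.inl hXd) (h1 a d (Or.inr (Or.inl hac)) (Or.inl hXd) hne)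
          fun h => hG.not_head_of_anc (.tail (.single hXd) h) (Or.inl hac)
        have had' : G.dir a d :=
          had.resolve_right (hG.not_bi_of_anc (.tail (.single hac) hXd))
        exact .head ⟨had', ha, hd⟩ hdy
      · exact .head ⟨hac, ha, hc⟩ (ih.1 hc)
    · rintro rfl
      have hc : c ≠ a := (hG.ne_of_dir hac).symm
      exact ⟨c, hac, hc, ih.1 hc⟩

theorem adj_induce_iff {G : MixedGraph V} {S : Set V} {x y : V} (hx : x ∈ S) (hy : y ∈ S) :
    (G.induce S).adj x y ↔ G.adj x y := by
  simp [adj, induce, hx, hy]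

theorem head_induce_iff {G : MixedGraph V} {S : Set V} {x y : V} (hx : x ∈ S) (hy : y ∈ S) :
    (G.induce S).head x y ↔ G.head x y := by
  simp [head, induce, hx, hy]

theorem adj_induce_mem {G : MixedGraph V} {S : Set V} {x y : V} (h : (G.induce S).adj x y) :
    x ∈ S ∧ y ∈ S := by
  rcases h with h | h | h | h
  exacts [h.2, h.2.symm, h.2, h.2]

theorem Triples.mem_of_induce {G : MixedGraph V} {S : Set V} {T : V → V → V → Prop} {p : List V}
    (h : Triples (G.induce S).adj T p) (hl : 2 ≤ p.length) : ∀ v ∈ p, v ∈ S := by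
  induction p with
  | nil => simp
  | cons u l ih =>
    match l, h, ih with
    | [], _, _ => simp at hl
    | [v], h, _ => simpa using adj_induce_mem h
    | v :: w :: l, h, ih =>
      intro x hx
      rcases List.mem_cons.1 hx with rfl | hx
      · exact (adj_induce_mem h.1).1
      · exact ih h.2.2 (by simp) x hx

theorem triples_congr {R R' : V → V → Prop} {S S' : V → V → V → Prop} {p : List V}
    (hR : ∀ u ∈ p, ∀ v ∈ p, R u v → R' u v)
    (hS : ∀ u ∈ p, ∀ v ∈ p, ∀ w ∈ p, S u v w → S' u v w) (h : Triples R S p) :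
    Triples R' S' p := by
  induction p with
  | nil => trivial
  | cons u l ih =>
    match l, h, ih with
    | [], _, _ => trivial
    | [v], h, _ => exact hR u (by simp) v (by simp) h
    | v :: w :: l, h, ih =>
      refine ⟨hR u (by simp) v (by simp) h.1, hS u (by simp) v (by simp) w (by simp) h.2.1,
        ih ?_ ?_ h.2.2⟩
      · exact fun u hu v hv => hR u (List.mem_cons_of_mem _ hu) v (List.mem_cons_of_mem _ hv)
      · exact fun u hu v hv w hw => hS u (List.mem_cons_of_mem _ hu) v (List.mem_cons_of_mem _ hv)
          w (List.mem_cons_of_mem _ hw)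

end MixedGraph

open MixedGraph in
/-- In a MAG, the two adjacency conditions of the graphical
characterization imply that `X` is removable. -/
theorem stmt2 {V : Type*} (G : MixedGraph V) (hG : G.IsMAG) (X : V)
    (h1 : G.RemCond1 X) (h2 : G.RemCond2 X) :
    G.Removable X := by
  intro Y W hY hW hYW Z hZ
  have hXS : X ∉ ({Y, W} ∪ Z : Set V) := by
    rintro ((h | h) | h)
    · exact hY h.symm
    · exact hW h.symm
    · exact (hZ h).1 rfl
  constructor
  · intro hsep p hp
    obtain ⟨hT, hn, hl, hY', hW'⟩ := mConn_iff_triples.1 hp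
    have hmem := hT.mem_of_induce hl
    refine hsep p (mConn_iff_triples.2 ⟨triples_congr ?_ ?_ hT, hn, hl, hY', hW'⟩)
    · exact fun u hu v hv => (adj_induce_iff (hmem u hu) (hmem v hv)).1
    · intro u hu v hv w hw h
      unfold Unblocked at h ⊢
      rw [head_induce_iff (hmem u hu) (hmem v hv), head_induce_iff (hmem w hw) (hmem v hv)] at h
      refine ⟨fun hc => ?_, h.2⟩
      obtain ⟨s, hs, ha⟩ := h.1 hc
      exact ⟨s, hs, anc_of_induce ha⟩
  · intro hsep p hp
    obtain ⟨hT, hn, -, hY', hW'⟩ := mConn_iff_triples.1 hp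
    obtain ⟨q, hq, hqn, hXq, hqY, hqW⟩ :=
      exists_triples_avoiding hG.1 h1 h2 hY hW hXS hT hn hY' hW'
    have hmem : ∀ v ∈ q, v ∈ {v | v ≠ X} := by
      rintro v hv rfl
      exact hXq hv
    refine hsep q (mConn_iff_triples.2 ⟨triples_congr ?_ ?_ hq, hqn, ?_, hqY, hqW⟩)
    · exact fun u hu v hv => (adj_induce_iff (hmem u hu) (hmem v hv)).2
    · intro u hu v hv w hw h
      unfold Unblocked at h ⊢
      rw [head_induce_iff (hmem u hu) (hmem v hv), head_induce_iff (hmem w hw) (hmem v hv)]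
      refine ⟨fun hc => ?_, h.2⟩
      obtain ⟨s, hs, ha⟩ := h.1 hc
      refine ⟨s, hs, anc_induce_of_anc hG.1 h1 (hmem v hv) ?_ ha⟩
      rintro rfl
      exact hXS hs
    · match q, hqY, hqW with
      | [u], hu, hw =>
        simp only [List.head?_cons, List.getLast?_singleton, Option.some.injEq] at hu hw
        exact absurd (hu.symm.trans hw) hYW
      | _ :: _ :: _, _, _ => simp
end

section
/- Let G be a MAG with removable vertex X and H the induced subgraph of G on V\{X}. Then for all Y ∈ V\{X}, the set of descendants of Y in G minus {X} equals the set of descendants of Y in H. (Consequence: removability implies that whenever Y ∈ Pa(X) and Z ∈ Ch(X), Y is adjacent to Z with an edge into Z, so directed paths through X can be shortcut.) -/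
namespace MixedGraph

variable {V : Type*} {G : MixedGraph V}

theorem adj_of_adj_induce {S : Set V} {x y : V} (h : (G.induce S).adj x y) :
    G.adj x y ∧ y ∈ S := by
  simp only [adj, induce] at *
  tauto

theorem anc_of_anc_induce {S : Set V} {x y : V} (h : (G.induce S).anc x y) : G.anc x y :=
  Relation.ReflTransGen.mono (fun _ _ h => h.1) _ _ h

theorem forall_mem_of_isChain_induce {S : Set V} :
    ∀ {p : List V} {x : V}, p.IsChain (G.induce S).adj → p.head? = some x → x ∈ S →
      ∀ v ∈ p, v ∈ S
  | [], _, _, _, _, v, hv => by simp at hv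
  | [a], x, _, hx, hxS, v, hv => by simp_all
  | a :: b :: l, x, h, hx, hxS, v, hv => by
    rw [List.isChain_cons_cons] at h
    rcases List.mem_cons.1 hv with rfl | hv
    · simp_all
    · exact forall_mem_of_isChain_induce h.2 rfl (adj_of_adj_induce h.1).2 v hv

theorem colliderAt_induce_iff {S : Set V} {p : List V} (hp : ∀ v ∈ p, v ∈ S) (i : ℕ) :
    (G.induce S).ColliderAt p i ↔ G.ColliderAt p i := by
  constructor
  · rintro ⟨a, v, c, ha, hv, hc, h₁, h₂⟩
    exact ⟨a, v, c, ha, hv, hc, h₁.imp And.left And.left, h₂.imp And.left And.left⟩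
  · rintro ⟨a, v, c, ha, hv, hc, h₁, h₂⟩
    have hvS := hp v (List.mem_of_getElem? hv)
    have haS := hp a (List.mem_of_getElem? ha)
    have hcS := hp c (List.mem_of_getElem? hc)
    exact ⟨a, v, c, ha, hv, hc, h₁.imp (⟨·, haS, hvS⟩) (⟨·, haS, hvS⟩),
      h₂.imp (⟨·, hcS, hvS⟩) (⟨·, hcS, hvS⟩)⟩

/-- Separating sets restrict to induced subgraphs. -/
theorem MSep.induce {S Z : Set V} {x y : V} (hx : x ∈ S) (h : G.MSep x y Z) :
    (G.induce S).MSep x y (Z ∩ S) := by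
  rintro p ⟨⟨⟨hchain, hnodup, hlen⟩, hhead, hlast⟩, hp⟩
  have hmem := forall_mem_of_isChain_induce hchain hhead hx
  refine h p ⟨⟨⟨hchain.imp fun _ _ h => (adj_of_adj_induce h).1, hnodup, hlen⟩, hhead, hlast⟩,
    fun i v h₁ h₂ hv => ?_⟩
  obtain ⟨hcol, hncol⟩ := hp i v h₁ h₂ hv
  rw [colliderAt_induce_iff hmem] at hcol hncol
  refine ⟨fun hc => ?_, fun hc hvZ => hncol hc ⟨hvZ, hmem v (List.mem_of_getElem? hv)⟩⟩
  obtain ⟨w, hw, hvw⟩ := hcol hc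
  exact ⟨w, hw.imp id And.left, anc_of_anc_induce hvw⟩

theorem Ancestral.not_dir_self (hG : G.Ancestral) (x : V) : ¬ G.dir x x :=
  fun h => hG.1 x x h .refl

theorem Ancestral.ne_of_dir_of_dir (hG : G.Ancestral) {x y z : V} (hyx : G.dir y x)
    (hxz : G.dir x z) : y ≠ z := by
  rintro rfl
  exact hG.1 y x hyx (.single hxz)

theorem Ancestral.mConn_of_dir_of_dir (hG : G.Ancestral) {x y z : V} {Z : Set V}
    (hyx : G.dir y x) (hxz : G.dir x z) (hx : x ∉ Z) : G.MConn [y, x, z] y z Z := by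
  have hyz := hG.ne_of_dir_of_dir hyx hxz
  have hyx' : y ≠ x := fun h => hG.not_dir_self x (h ▸ hyx)
  have hxz' : x ≠ z := fun h => hG.not_dir_self x (h ▸ hxz)
  refine ⟨⟨⟨?_, by simp [*], by simp⟩, rfl, rfl⟩, fun i v h₁ h₂ hv => ?_⟩
  · exact .cons_cons (.inl hyx) (.cons_cons (.inl hxz) (.singleton _))
  · obtain rfl : i = 1 := by simp at h₂; omega
    obtain rfl : x = v := by simpa using hv
    refine ⟨?_, fun _ => hx⟩
    rintro ⟨a, v, c, -, hv, hc, -, h⟩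
    obtain rfl : x = v := by simpa using hv
    obtain rfl : z = c := by simpa using hc
    rcases h with h | h
    · exact (hG.1 z x h (.single hxz)).elim
    · exact (hG.2.1 z x h (.single hxz)).elim

theorem IsMAG.adj_of_removable (hG : G.IsMAG) {x y z : V} (hx : G.Removable x)
    (hyx : G.dir y x) (hxz : G.dir x z) : G.adj y z := by
  by_contra hadj
  have hyz := hG.1.ne_of_dir_of_dir hyx hxz
  have hyx' : y ≠ x := fun h => hG.1.not_dir_self x (h ▸ hyx)
  have hzx' : z ≠ x := fun h => hG.1.not_dir_self x (h ▸ hxz)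
  obtain ⟨Z, hZ, hsep⟩ := hG.2 y z hyz hadj
  have hsep' := (hx y z hyx' hzx' hyz (Z ∩ {v | v ≠ x}) fun v hv => ⟨hv.2, hZ hv.1⟩).2
    (hsep.induce hyx')
  exact hsep' _ (hG.1.mConn_of_dir_of_dir hyx hxz fun h => h.2 rfl)

/-- Directed paths through a removable vertex can be shortcut. -/
theorem IsMAG.dir_of_removable (hG : G.IsMAG) {x y z : V} (hx : G.Removable x)
    (hyx : G.dir y x) (hxz : G.dir x z) : G.dir y z := by
  have hanc : G.anc y z := .tail (.single hyx) hxz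
  rcases hG.adj_of_removable hx hyx hxz with h | h | h | h
  · exact h
  · exact (hG.1.1 z y h hanc).elim
  · exact (hG.1.2.1 z y (G.bi_symm _ _ h) hanc).elim
  · exact ((hG.1.2.2 z y (G.und_symm _ _ h) x).1 hxz).elim

theorem IsMAG.anc_induce_of_removable (hG : G.IsMAG) {x y w : V} (hx : G.Removable x)
    (hy : y ≠ x) (h : G.anc y w) :
    (w ≠ x → (G.induce {v | v ≠ x}).anc y w) ∧
      (w = x → ∃ u, u ≠ x ∧ (G.induce {v | v ≠ x}).anc y u ∧ G.dir u x) := by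
  induction h with
  | refl => exact ⟨fun _ => .refl, fun h => (hy h).elim⟩
  | @tail b c _ hbc ih =>
    by_cases hb : b = x
    · subst hb
      obtain ⟨u, hu, hyu, hub⟩ := ih.2 rfl
      exact ⟨fun hc => .tail hyu ⟨hG.dir_of_removable hx hub hbc, hu, hc⟩,
        fun hc => (hG.1.not_dir_self b (hc ▸ hbc)).elim⟩
    · exact ⟨fun hc => .tail (ih.1 hb) ⟨hbc, hb, hc⟩, fun hc => ⟨b, hb, ih.1 hb, hc ▸ hbc⟩⟩

theorem ne_of_anc_induce {x y w : V} (hy : y ≠ x)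
    (h : (G.induce {v | v ≠ x}).anc y w) : w ≠ x := by
  cases h with
  | refl => exact hy
  | tail _ h => exact h.2.2

end MixedGraph

open MixedGraph in
/-- for a removable vertex `X` of a MAG `G`, the descendants of
any `Y ≠ X` in `G`, minus `X`, are exactly its descendants in the induced
subgraph on `V \ {X}`. -/
theorem stmt15 {V : Type*} (G : MixedGraph V) (hG : G.IsMAG) (X : V)
    (hrem : G.Removable X) :
    ∀ Y : V, Y ≠ X →
      G.desc Y \ {X} = (G.induce {v | v ≠ X}).desc Y := by
  intro Y hY
  ext W
  exact ⟨fun h => (hG.anc_induce_of_removable hrem hY h.1).1 h.2,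
    fun h => ⟨anc_of_anc_induce h, ne_of_anc_induce hY h⟩⟩
end
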